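/- arXiv:1806.04025 — 2 statements merged into one kernel-verified Lean document; each statement's English description precedes it below -/
import Mathlib

section
/- Let D be a countable dense subset of X. For every finite signed Borel measure μ on X and every ε > 0 there exist n ∈ ℕ, points x_1,…,x_n ∈ D and rational numbers c_1,…,c_n such that, setting ν = ∑_{i=1}^n c_i δ_{x_i} (a rational linear combination of Dirac measures), one has B(μ−ν, μ−ν) < ε. (Hence the rational linear combinations of Dirac measures at points of D are dense in the signed measures with respect to the seminorm B(·,·)^{1/2}; this yields separability of the covariance spaces U'_Q and underlies the construction of the predictable orthonormal systems built from Dirac measures at a countable dense set of points.) -/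
open MeasureTheory

/-- Integral of a real-valued function against a finite signed Borel measure,
defined via the Jordan decomposition. -/
noncomputable def signedIntegral {X : Type*} [MeasurableSpace X]
    (μ : SignedMeasure X) (f : X → ℝ) : ℝ :=
  (∫ x, f x ∂μ.toJordanDecomposition.posPart) -
    (∫ x, f x ∂μ.toJordanDecomposition.negPart)

/-- The kernel bilinear form `B(μ,ν) = ∬ Q(x,y) dμ(x) dν(y)`. -/
noncomputable def kernelForm {X : Type*} [MeasurableSpace X] (Q : X → X → ℝ)
    (μ ν : SignedMeasure X) : ℝ :=
  signedIntegral ν (fun y => signedIntegral μ (fun x => Q x y))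

theorem Continuous.integrable_of_compactSpace {X : Type*} [TopologicalSpace X] [CompactSpace X]
    [MeasurableSpace X] [OpensMeasurableSpace X] {f : X → ℝ} (hf : Continuous f)
    (μ : Measure X) [IsFiniteMeasure μ] : Integrable f μ :=
  hf.integrable_of_hasCompactSupport (HasCompactSupport.of_compactSpace f)

section SignedIntegral

variable {X : Type*} [MeasurableSpace X]

/-- The signed integral may be computed from any decomposition as a difference of measures. -/
theorem signedIntegral_eq_of_eq_sub {μ : SignedMeasure X} {p q : Measure X}
    [IsFiniteMeasure p] [IsFiniteMeasure q] (h : μ = p.toSignedMeasure - q.toSignedMeasure)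
    {f : X → ℝ} (hf : ∀ ν : Measure X, IsFiniteMeasure ν → Integrable f ν) :
    signedIntegral μ f = (∫ x, f x ∂p) - ∫ x, f x ∂q := by
  have key : μ.toJordanDecomposition.posPart + q = p + μ.toJordanDecomposition.negPart := by
    rw [← Measure.toSignedMeasure_eq_toSignedMeasure_iff, Measure.toSignedMeasure_add,
      Measure.toSignedMeasure_add, ← sub_eq_sub_iff_add_eq_add]
    exact μ.toSignedMeasure_toJordanDecomposition.trans h
  have h2 := congrArg (fun ν : Measure X => ∫ x, f x ∂ν) key
  rw [integral_add_measure (hf _ inferInstance) (hf _ inferInstance),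
    integral_add_measure (hf _ inferInstance) (hf _ inferInstance)] at h2
  unfold signedIntegral
  linarith

theorem signedIntegral_sub_smul_dirac (μ : SignedMeasure X) (c : ℝ) (a : X)
    {f : X → ℝ} (hfm : StronglyMeasurable f)
    (hf : ∀ ν : Measure X, IsFiniteMeasure ν → Integrable f ν) :
    signedIntegral (μ - c • (Measure.dirac a).toSignedMeasure) f =
      signedIntegral μ f - c * f a := by
  have h : μ - c • (Measure.dirac a).toSignedMeasure =
      (μ.toJordanDecomposition.posPart + (-c).toNNReal • Measure.dirac a).toSignedMeasure -
      (μ.toJordanDecomposition.negPart + c.toNNReal • Measure.dirac a).toSignedMeasure := by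
    have hμ : μ.toJordanDecomposition.posPart.toSignedMeasure -
      μ.toJordanDecomposition.negPart.toSignedMeasure = μ :=
        μ.toSignedMeasure_toJordanDecomposition
    have hc : c = (c.toNNReal : ℝ) - ((-c).toNNReal : ℝ) := by
      rw [Real.coe_toNNReal', Real.coe_toNNReal', max_zero_sub_max_neg_zero_eq_self]
    rw [Measure.toSignedMeasure_add, Measure.toSignedMeasure_add, Measure.toSignedMeasure_smul,
      Measure.toSignedMeasure_smul, add_sub_add_comm, hμ]
    ext s hs
    simp only [FunLike.coe_sub, FunLike.coe_add, FunLike.coe_smul, Pi.sub_apply, Pi.add_apply,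
      Pi.smul_apply, NNReal.smul_def, smul_eq_mul]
    linear_combination (-(Measure.dirac a).toSignedMeasure s) * hc
  rw [signedIntegral_eq_of_eq_sub h hf,
    integral_add_measure (hf _ inferInstance) (hf _ inferInstance),
    integral_add_measure (hf _ inferInstance) (hf _ inferInstance),
    integral_smul_nnreal_measure, integral_smul_nnreal_measure,
    integral_dirac' _ _ hfm, signedIntegral, NNReal.smul_def, NNReal.smul_def,
    Real.coe_toNNReal', Real.coe_toNNReal', smul_eq_mul, smul_eq_mul]
  linear_combination (-f a) * max_zero_sub_max_neg_zero_eq_self c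

theorem signedIntegral_sub_sum_smul_dirac {ι : Type*} (μ : SignedMeasure X) (s : Finset ι)
    (c : ι → ℝ) (a : ι → X) {f : X → ℝ} (hfm : StronglyMeasurable f)
    (hf : ∀ ν : Measure X, IsFiniteMeasure ν → Integrable f ν) :
    signedIntegral (μ - ∑ i ∈ s, c i • (Measure.dirac (a i)).toSignedMeasure) f =
      signedIntegral μ f - ∑ i ∈ s, c i * f (a i) := by
  classical
  induction s using Finset.induction_on with
  | empty => simp
  | insert i s his ih =>
    rw [Finset.sum_insert his, Finset.sum_insert his, add_comm, ← sub_sub,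
      signedIntegral_sub_smul_dirac _ _ _ hfm hf, ih]
    ring

theorem abs_signedIntegral_le (μ : SignedMeasure X) {f : X → ℝ} {C : ℝ} (hf : ∀ x, |f x| ≤ C) :
    |signedIntegral μ f| ≤ C * (μ.toJordanDecomposition.posPart.real Set.univ +
      μ.toJordanDecomposition.negPart.real Set.univ) := by
  have h1 := norm_integral_le_of_norm_le_const (μ := μ.toJordanDecomposition.posPart)
    (f := f) (Filter.Eventually.of_forall hf)
  have h2 := norm_integral_le_of_norm_le_const (μ := μ.toJordanDecomposition.negPart)
    (f := f) (Filter.Eventually.of_forall hf)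
  rw [mul_add]
  exact (abs_sub _ _).trans (add_le_add h1 h2)

/-- Replacing a function by its values at sample points of a finite measurable partition. -/
theorem abs_integral_sub_sum_le {n : ℕ} {A : Fin n → Set X} (hA : ∀ i, MeasurableSet (A i))
    (hdisj : Pairwise (Function.onFun Disjoint A)) (hcov : ⋃ i, A i = Set.univ)
    (a : Fin n → X) (ν : Measure X) [IsFiniteMeasure ν] {f : X → ℝ} (hf : Integrable f ν)
    {η : ℝ} (hη : ∀ i, ∀ x ∈ A i, |f x - f (a i)| ≤ η) :
    |∫ x, f x ∂ν - ∑ i, ν.real (A i) * f (a i)| ≤ η * ν.real Set.univ := by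
  have h1 : ∫ x, f x ∂ν = ∑ i, ∫ x in A i, f x ∂ν := by
    rw [← integral_iUnion_fintype hA hdisj fun i => hf.integrableOn, hcov, setIntegral_univ]
  have h2 (i : Fin n) : ∫ x in A i, f x ∂ν - ν.real (A i) * f (a i) =
      ∫ x in A i, (f x - f (a i)) ∂ν := by
    rw [integral_sub hf.integrableOn (integrable_const _), setIntegral_const, smul_eq_mul]
  rw [h1, ← Finset.sum_sub_distrib, ← hcov, measureReal_iUnion_fintype hdisj hA, Finset.mul_sum]
  refine (Finset.abs_sum_le_sum_abs _ _).trans (Finset.sum_le_sum fun i _ => ?_)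
  rw [h2]
  exact norm_setIntegral_le_of_norm_le_const (f := fun x => f x - f (a i))
    (measure_lt_top _ _) (hη i)

end SignedIntegral

/-- A compact metric space has finite measurable partitions of small mesh, subordinate to
sample points in a given dense set. -/
theorem exists_fin_measurable_partition_dist_lt {X : Type*} [PseudoMetricSpace X] [CompactSpace X]
    [MeasurableSpace X] [OpensMeasurableSpace X] {D : Set X} (hD : Dense D) {r : ℝ} (hr : 0 < r) :
    ∃ (n : ℕ) (a : Fin n → X) (A : Fin n → Set X), (∀ i, a i ∈ D) ∧
      (∀ i, MeasurableSet (A i)) ∧ Pairwise (Function.onFun Disjoint A) ∧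
      ⋃ i, A i = Set.univ ∧ ∀ i, ∀ x ∈ A i, dist x (a i) < r := by
  obtain ⟨t, ht⟩ := isCompact_univ.elim_finite_subcover (fun d : D => Metric.ball (d : X) r)
    (fun _ => Metric.isOpen_ball) (fun x _ => by
      obtain ⟨d, hd, hxd⟩ := hD.exists_dist_lt x hr
      exact Set.mem_iUnion.2 ⟨⟨d, hd⟩, hxd⟩)
  let a : Fin t.card → X := fun i => ((t.equivFin.symm i : D) : X)
  refine ⟨t.card, a, disjointed fun i => Metric.ball (a i) r,
    fun i => (t.equivFin.symm i : D).2, fun i => ?_, disjoint_disjointed _, ?_, fun i x hx => ?_⟩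
  · exact disjointedRec (fun _ _ h => h.diff measurableSet_ball) measurableSet_ball
  · rw [iUnion_disjointed, Set.eq_univ_iff_forall]
    intro x
    obtain ⟨d, hd, hx⟩ := Set.mem_iUnion₂.1 (ht (Set.mem_univ x))
    refine Set.mem_iUnion.2 ⟨t.equivFin ⟨d, hd⟩, ?_⟩
    simpa [a] using hx
  · exact disjointed_subset _ i hx

theorem continuous_signedIntegral_left {X : Type*} [PseudoMetricSpace X] [CompactSpace X]
    [MeasurableSpace X] [OpensMeasurableSpace X] {Q : X → X → ℝ}
    (hQ : Continuous fun p : X × X => Q p.1 p.2) (μ : SignedMeasure X) :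
    Continuous fun y => signedIntegral μ fun x => Q x y := by
  have h (ν : Measure X) [IsFiniteMeasure ν] : Continuous fun y => ∫ x, Q x y ∂ν := by
    have := continuous_parametric_integral_of_continuous (μ := ν) (f := fun y x => Q x y)
      (hQ.comp continuous_swap) isCompact_univ
    simpa only [setIntegral_univ] using this
  exact (h _).sub (h _)

theorem dirac_combinations_dense_in_kernelForm {X : Type*} [MetricSpace X]
    [CompactSpace X] [MeasurableSpace X] [BorelSpace X]
    (Q : X → X → ℝ) (hQcont : Continuous fun p : X × X => Q p.1 p.2)
    (hQsymm : ∀ x y : X, Q x y = Q y x)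
    (hQpos : ∀ (d : ℕ) (x : Fin d → X) (c : Fin d → ℝ),
      0 ≤ ∑ i, ∑ j, Q (x i) (x j) * c i * c j)
    (D : Set X) (hDcount : D.Countable) (hDdense : Dense D) :
    ∀ μ : SignedMeasure X, ∀ ε : ℝ, 0 < ε →
      ∃ (n : ℕ) (x : Fin n → X) (c : Fin n → ℚ), (∀ i, x i ∈ D) ∧
        kernelForm Q
          (μ - ∑ i, (c i : ℝ) • (Measure.dirac (x i)).toSignedMeasure)
          (μ - ∑ i, (c i : ℝ) • (Measure.dirac (x i)).toSignedMeasure) < ε := by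
  intro μ ε hε
  set P := μ.toJordanDecomposition.posPart with hP
  set N := μ.toJordanDecomposition.negPart with hN
  set V : ℝ := P.real Set.univ + N.real Set.univ with hV
  have hV0 : 0 ≤ V := by positivity
  obtain ⟨M, hM0, hM⟩ : ∃ M : ℝ, 0 ≤ M ∧ ∀ x y, |Q x y| ≤ M := by
    obtain ⟨M, hM⟩ := isCompact_univ.exists_bound_of_continuousOn hQcont.continuousOn
    exact ⟨max M 0, le_max_right _ _, fun x y =>
      (hM (x, y) (Set.mem_univ _)).trans (le_max_left _ _)⟩
  obtain ⟨η, hη0, hη1, hηε⟩ : ∃ η : ℝ, 0 < η ∧ η ≤ 1 ∧ η * (V + M) * (2 * V + 1) < ε := by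
    have hK : 0 < (V + M) * (2 * V + 1) + 1 := by positivity
    refine ⟨min 1 (ε / ((V + M) * (2 * V + 1) + 1)), by positivity, min_le_left _ _, ?_⟩
    have hle := min_le_right 1 (ε / ((V + M) * (2 * V + 1) + 1))
    rw [le_div_iff₀ hK] at hle
    have : 0 < min 1 (ε / ((V + M) * (2 * V + 1) + 1)) := by positivity
    linarith
  obtain ⟨r, hr, hQr⟩ := Metric.uniformContinuous_iff.1
    (CompactSpace.uniformContinuous_of_continuous hQcont) η hη0
  obtain ⟨n, a, A, haD, hAm, hAd, hAc, hAr⟩ := exists_fin_measurable_partition_dist_lt hDdense hr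
  have hQA (y : X) : ∀ i, ∀ x ∈ A i, |Q x y - Q (a i) y| ≤ η := fun i x hx =>
    (hQr (a := (x, y)) (b := (a i, y)) (by simpa [Prod.dist_eq, hr] using hAr i x hx)).le
  let m : Fin n → ℝ := fun i => P.real (A i) - N.real (A i)
  have hc (i : Fin n) : ∃ q : ℚ, |m i - q| < η / (n + 1) :=
    exists_rat_near (m i) (by positivity)
  choose c hc using hc
  have hcsum : ∑ i, |m i - c i| ≤ η := by
    calc ∑ i, |m i - c i| ≤ ∑ _i : Fin n, η / (n + 1) := Finset.sum_le_sum fun i _ => (hc i).le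
      _ = n / (n + 1) * η := by simp; ring
      _ ≤ 1 * η := by
        gcongr
        rw [div_le_one (by positivity)]
        linarith
      _ = η := one_mul η
  have hmsum : ∑ i, |m i| ≤ V := by
    rw [hV, ← hAc, measureReal_iUnion_fintype hAd hAm, measureReal_iUnion_fintype hAd hAm,
      ← Finset.sum_add_distrib]
    refine Finset.sum_le_sum fun i _ => (abs_sub _ _).trans_eq ?_
    rw [abs_of_nonneg measureReal_nonneg, abs_of_nonneg measureReal_nonneg]
  have hcabs : ∑ i, |(c i : ℝ)| ≤ V + 1 := by
    calc ∑ i, |(c i : ℝ)| ≤ ∑ i, (|m i| + |m i - c i|) := Finset.sum_le_sum fun i _ => by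
          have := abs_sub (m i) (m i - c i)
          rwa [sub_sub_cancel] at this
      _ ≤ V + 1 := by
        rw [Finset.sum_add_distrib]
        linarith
  have hint {f : X → ℝ} (hf : Continuous f) (ν : Measure X) (_ : IsFiniteMeasure ν) :
      Integrable f ν := hf.integrable_of_compactSpace ν
  refine ⟨n, a, c, haD, ?_⟩
  set ρ : SignedMeasure X := μ - ∑ i, (c i : ℝ) • (Measure.dirac (a i)).toSignedMeasure with hρ
  let g : X → ℝ := fun y => signedIntegral ρ fun x => Q x y
  have hgc : Continuous g := continuous_signedIntegral_left hQcont ρ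
  have hg (y : X) : |g y| ≤ η * (V + M) := by
    have hQy : Continuous fun x => Q x y := hQcont.comp (by fun_prop : Continuous fun x => (x, y))
    have hgy : g y = (∫ x, Q x y ∂P - ∑ i, P.real (A i) * Q (a i) y) -
        (∫ x, Q x y ∂N - ∑ i, N.real (A i) * Q (a i) y) + ∑ i, (m i - c i) * Q (a i) y := by
      simp only [g, hρ, m]
      rw [signedIntegral_sub_sum_smul_dirac _ _ _ _ hQy.stronglyMeasurable (hint hQy)]
      simp only [signedIntegral, sub_mul, Finset.sum_sub_distrib, ← hP, ← hN]
      ring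
    have h1 := abs_integral_sub_sum_le hAm hAd hAc a P (hint hQy P inferInstance) (hQA y)
    have h2 := abs_integral_sub_sum_le hAm hAd hAc a N (hint hQy N inferInstance) (hQA y)
    have h3 : |∑ i, (m i - c i) * Q (a i) y| ≤ η * M := by
      calc |∑ i, (m i - c i) * Q (a i) y| ≤ ∑ i, |(m i - c i) * Q (a i) y| :=
            Finset.abs_sum_le_sum_abs _ _
        _ ≤ ∑ i, |m i - c i| * M := Finset.sum_le_sum fun i _ => by
            rw [abs_mul]
            exact mul_le_mul_of_nonneg_left (hM _ _) (abs_nonneg _)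
        _ ≤ η * M := by
            rw [← Finset.sum_mul]
            exact mul_le_mul_of_nonneg_right hcsum hM0
    rw [hgy]
    calc _ ≤ η * P.real Set.univ + η * N.real Set.univ + η * M :=
          (abs_add_le _ _).trans (add_le_add ((abs_sub _ _).trans (add_le_add h1 h2)) h3)
      _ = η * (V + M) := by rw [hV]; ring
  have hδ : 0 ≤ η * (V + M) := by positivity
  calc kernelForm Q ρ ρ = signedIntegral μ g - ∑ i, (c i : ℝ) * g (a i) :=
        signedIntegral_sub_sum_smul_dirac μ Finset.univ _ a hgc.stronglyMeasurable (hint hgc)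
    _ ≤ |signedIntegral μ g| + |∑ i, (c i : ℝ) * g (a i)| :=
        (le_abs_self _).trans (abs_sub _ _)
    _ ≤ η * (V + M) * V + η * (V + M) * (V + 1) := by
        refine add_le_add (abs_signedIntegral_le μ hg) ?_
        calc |∑ i, (c i : ℝ) * g (a i)| ≤ ∑ i, |(c i : ℝ) * g (a i)| :=
              Finset.abs_sum_le_sum_abs _ _
          _ ≤ ∑ i, η * (V + M) * |(c i : ℝ)| := Finset.sum_le_sum fun i _ => by
              rw [abs_mul, mul_comm]
              exact mul_le_mul_of_nonneg_right (hg _) (abs_nonneg _)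
          _ ≤ η * (V + M) * (V + 1) := by
              rw [← Finset.mul_sum]
              exact mul_le_mul_of_nonneg_left hcabs hδ
    _ = η * (V + M) * (2 * V + 1) := by ring
    _ < ε := hηε
end

section
/- For every p > 0, every t ∈ [0,T], and every Borel measurable h : [0,T] → ℝ, the weighted Cauchy–Schwarz inequality (∫_{(t,T]} |h(s)| dν(s))² ≤ (1/p)(e^{−pK(t)} − e^{−pK(T)}) · ∫_{(t,T]} e^{pK(s)} α(s)^{−2} h(s)² dν(s) holds. -/
open MeasureTheory

/-- A continuous monotone function that is a distribution function of `μ` on `(t, T]` pushes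
`μ` forward to Lebesgue measure. -/
theorem map_restrict_Ioc_eq_volume_restrict {μ : Measure ℝ} {K : ℝ → ℝ} {t T : ℝ} (htT : t ≤ T)
    (hcont : ContinuousOn K (Set.Icc t T)) (hmono : MonotoneOn K (Set.Icc t T))
    (hμ : ∀ u ∈ Set.Icc t T, μ (Set.Ioc t u) = ENNReal.ofReal (K u - K t)) :
    (μ.restrict (Set.Ioc t T)).map K = volume.restrict (Set.Ioc (K t) (K T)) := by
  have hKm : AEMeasurable K (μ.restrict (Set.Ioc t T)) :=
    (hcont.mono Set.Ioc_subset_Icc_self).aemeasurable measurableSet_Ioc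
  have htmem : t ∈ Set.Icc t T := ⟨le_rfl, htT⟩
  have hTmem : T ∈ Set.Icc t T := ⟨htT, le_rfl⟩
  have hfin : IsFiniteMeasure (μ.restrict (Set.Ioc t T)) :=
    ⟨by rw [Measure.restrict_apply_univ, hμ T hTmem]; exact ENNReal.ofReal_lt_top⟩
  refine Measure.ext_of_Iic _ _ fun x => ?_
  rw [Measure.map_apply_of_aemeasurable hKm measurableSet_Iic,
    Measure.restrict_apply measurableSet_Iic, Measure.restrict_apply' measurableSet_Ioc]
  rcases lt_or_ge x (K t) with hx | hx
  · have h1 : K ⁻¹' Set.Iic x ∩ Set.Ioc t T = ∅ := by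
      ext s
      simp only [Set.mem_inter_iff, Set.mem_preimage, Set.mem_Iic, Set.mem_Ioc,
        Set.mem_empty_iff_false, iff_false]
      rintro ⟨h, h'⟩
      linarith [hmono htmem ⟨h'.1.le, h'.2⟩ h'.1.le]
    have h2 : Set.Iic x ∩ Set.Ioc (K t) (K T) = ∅ := by
      ext s
      simp only [Set.mem_inter_iff, Set.mem_Iic, Set.mem_Ioc, Set.mem_empty_iff_false, iff_false]
      rintro ⟨h, h'⟩
      linarith
    rw [h1, h2, measure_empty, measure_empty]
  · have hclosed : IsClosed (Set.Icc t T ∩ K ⁻¹' Set.Iic x) :=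
      hcont.preimage_isClosed_of_isClosed isClosed_Icc isClosed_Iic
    have hcomp : IsCompact (Set.Icc t T ∩ K ⁻¹' Set.Iic x) :=
      isCompact_Icc.of_isClosed_subset hclosed Set.inter_subset_left
    obtain ⟨u, ⟨hu, hux⟩, humax⟩ := hcomp.exists_isGreatest ⟨t, htmem, hx⟩
    have h1 : K ⁻¹' Set.Iic x ∩ Set.Ioc t T = Set.Ioc t u := by
      ext s
      constructor
      · rintro ⟨h, h'⟩
        exact ⟨h'.1, humax ⟨⟨h'.1.le, h'.2⟩, h⟩⟩
      · rintro ⟨h, h'⟩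
        exact ⟨(hmono ⟨h.le, h'.trans hu.2⟩ hu h').trans hux, h, h'.trans hu.2⟩
    have hKu : K u = min x (K T) := by
      refine le_antisymm (le_min hux (hmono hu hTmem hu.2)) ?_
      obtain ⟨v, hv, hvx⟩ := intermediate_value_Icc htT hcont
        (show min x (K T) ∈ Set.Icc (K t) (K T) from
          ⟨le_min hx (hmono htmem hTmem htT), min_le_right _ _⟩)
      rw [← hvx]
      exact hmono hv hu (humax ⟨hv, by
        rw [Set.mem_preimage, hvx]; exact min_le_left x (K T)⟩)
    rw [h1, hμ u hu, Set.inter_comm, Set.Ioc_inter_Iic, Real.volume_Ioc, hKu, min_comm x]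

theorem setLIntegral_exp_neg_mul_Ioc {p : ℝ} (hp : 0 < p) {a b : ℝ} (hab : a ≤ b) :
    ∫⁻ x in Set.Ioc a b, ENNReal.ofReal (Real.exp (-p * x)) =
      ENNReal.ofReal ((1 / p) * (Real.exp (-p * a) - Real.exp (-p * b))) := by
  have hc : Continuous fun x : ℝ => Real.exp (-p * x) := by fun_prop
  rw [← ofReal_integral_eq_lintegral_ofReal
    (hc.integrableOn_Icc.mono_set Set.Ioc_subset_Icc_self)
    (Filter.Eventually.of_forall fun x => (Real.exp_pos _).le),
    ← intervalIntegral.integral_of_le hab,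
    intervalIntegral.integral_eq_sub_of_hasDerivAt
      (f := fun x => -(1 / p) * Real.exp (-p * x)) _ (hc.intervalIntegrable _ _)]
  · congr 1; ring
  · intro x _
    have hd := ((hasDerivAt_const_mul (-p) (x := x)).exp).const_mul (-(1 / p))
    have he : -(1 / p) * (Real.exp (-p * x) * -p) = Real.exp (-p * x) := by field_simp
    rwa [he] at hd

theorem sq_lintegral_mul_le {X : Type*} [MeasurableSpace X] (μ : Measure X)
    {f g : X → ENNReal} (hf : AEMeasurable f μ) (hg : AEMeasurable g μ) :
    (∫⁻ x, f x * g x ∂μ) ^ 2 ≤ (∫⁻ x, f x ^ 2 ∂μ) * ∫⁻ x, g x ^ 2 ∂μ := by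
  have h := ENNReal.lintegral_mul_le_Lp_mul_Lq μ Real.HolderConjugate.two_two hf hg
  have hsq : ∀ c : ENNReal, (c ^ (1 / 2 : ℝ)) ^ 2 = c := fun c => by
    rw [← ENNReal.rpow_natCast, ← ENNReal.rpow_mul]; norm_num
  calc (∫⁻ x, f x * g x ∂μ) ^ 2 ≤ _ := pow_le_pow_left' h 2
    _ = _ := by rw [mul_pow, hsq, hsq]; simp only [ENNReal.rpow_ofNat]

theorem weighted_cauchy_schwarz_estimate
    (T : ℝ) (hT : 0 < T) (ν : Measure ℝ) [IsFiniteMeasure ν]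
    (α : ℝ → ℝ) (hαmeas : Measurable α) (hαpos : ∀ s ∈ Set.Icc (0 : ℝ) T, 0 < α s)
    (hαint : IntegrableOn (fun s => α s ^ 2) (Set.Icc 0 T) ν)
    (K : ℝ → ℝ) (hK : ∀ t : ℝ, K t = ∫ s in Set.Ioc 0 t, α s ^ 2 ∂ν)
    (hKcont : ContinuousOn K (Set.Icc 0 T)) :
    ∀ p : ℝ, 0 < p → ∀ t ∈ Set.Icc (0 : ℝ) T, ∀ h : ℝ → ℝ, Measurable h →
      (∫⁻ s in Set.Ioc t T, ENNReal.ofReal |h s| ∂ν) ^ 2 ≤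
        ENNReal.ofReal ((1 / p) * (Real.exp (-p * K t) - Real.exp (-p * K T))) *
          ∫⁻ s in Set.Ioc t T,
            ENNReal.ofReal (Real.exp (p * K s) * (α s ^ 2)⁻¹ * h s ^ 2) ∂ν := by
  intro p hp t ht h hh
  have hincr : ∀ a b, 0 ≤ a → a ≤ b → b ≤ T →
      K b - K a = ∫ s in Set.Ioc a b, α s ^ 2 ∂ν := fun a b ha hab hb => by
    rw [hK, hK, ← Set.Ioc_union_Ioc_eq_Ioc ha hab,
      setIntegral_union (Set.Ioc_disjoint_Ioc_of_le le_rfl) measurableSet_Ioc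
        (hαint.mono_set fun s hs => ⟨hs.1.le, hs.2.trans (hab.trans hb)⟩)
        (hαint.mono_set fun s hs => ⟨ha.trans hs.1.le, hs.2.trans hb⟩)]
    ring
  have hmono : MonotoneOn K (Set.Icc t T) := fun a ha b hb hab => by
    rw [← sub_nonneg, hincr a b (ht.1.trans ha.1) hab hb.2]
    exact integral_nonneg fun s => sq_nonneg _
  have hcont : ContinuousOn K (Set.Icc t T) := hKcont.mono (Set.Icc_subset_Icc_left ht.1)
  have hKm : AEMeasurable K (ν.restrict (Set.Ioc t T)) :=
    (hcont.mono Set.Ioc_subset_Icc_self).aemeasurable measurableSet_Ioc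
  have hdens : Measurable fun s => ENNReal.ofReal (α s ^ 2) := by fun_prop
  have hmap := map_restrict_Ioc_eq_volume_restrict
    (μ := ν.withDensity fun s => ENNReal.ofReal (α s ^ 2)) ht.2 hcont hmono fun u hu => by
      rw [withDensity_apply _ measurableSet_Ioc, hincr t u ht.1 hu.1 hu.2,
        ofReal_integral_eq_lintegral_ofReal
          (hαint.mono_set fun s hs => ⟨ht.1.trans hs.1.le, hs.2.trans hu.2⟩)
          (Filter.Eventually.of_forall fun s => sq_nonneg _)]
  have hweight : ∫⁻ s in Set.Ioc t T,
      ENNReal.ofReal (α s ^ 2) * ENNReal.ofReal (Real.exp (-p * K s)) ∂ν =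
      ENNReal.ofReal ((1 / p) * (Real.exp (-p * K t) - Real.exp (-p * K T))) := by
    rw [← setLIntegral_exp_neg_mul_Ioc hp (hmono ⟨le_rfl, ht.2⟩ ⟨ht.2, le_rfl⟩ ht.2), ← hmap,
      lintegral_map' (by fun_prop)
        ((hcont.mono Set.Ioc_subset_Icc_self).aemeasurable measurableSet_Ioc),
      restrict_withDensity measurableSet_Ioc,
      lintegral_withDensity_eq_lintegral_mul₀ hdens.aemeasurable (by fun_prop)]
    rfl
  have hf : AEMeasurable (fun s => ENNReal.ofReal (α s * Real.exp (-p * K s / 2)))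
      (ν.restrict (Set.Ioc t T)) := by fun_prop
  have hg : AEMeasurable (fun s => ENNReal.ofReal (Real.exp (p * K s / 2) * (α s)⁻¹ * |h s|))
      (ν.restrict (Set.Ioc t T)) := by fun_prop
  have hpos : ∀ s ∈ Set.Ioc t T, 0 < α s := fun s hs => hαpos s ⟨ht.1.trans hs.1.le, hs.2⟩
  have hexp : ∀ x : ℝ, Real.exp (x / 2) ^ 2 = Real.exp x := fun x => by
    rw [← Real.exp_nat_mul]; congr 1; push_cast; ring
  rw [← hweight]
  convert sq_lintegral_mul_le _ hf hg using 1
  · congr 1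
    refine setLIntegral_congr_fun measurableSet_Ioc fun s hs => ?_
    have hα := hpos s hs
    have hone : Real.exp (-p * K s / 2) * Real.exp (p * K s / 2) = 1 := by
      rw [← Real.exp_add, ← Real.exp_zero]; congr 1; ring
    rw [← ENNReal.ofReal_mul (by positivity)]
    congr 1
    calc |h s| = (α s * (α s)⁻¹) * (Real.exp (-p * K s / 2) * Real.exp (p * K s / 2)) * |h s| := by
          rw [hone, mul_inv_cancel₀ hα.ne']; ring
      _ = _ := by ring
  · congr 1
    · refine setLIntegral_congr_fun measurableSet_Ioc fun s hs => ?_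
      have hα := hpos s hs
      rw [← ENNReal.ofReal_mul (by positivity), ← ENNReal.ofReal_pow (by positivity), mul_pow, hexp]
    · refine setLIntegral_congr_fun measurableSet_Ioc fun s hs => ?_
      have hα := hpos s hs
      rw [← ENNReal.ofReal_pow (by positivity), mul_pow, mul_pow, hexp, sq_abs, inv_pow]
end
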